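/- arXiv:2312.16590 — 4 statements merged into one kernel-verified Lean document; each statement's English description precedes it below -/
import Mathlib

section
/- Let K be a field, let d ≥ 1 and ℓ ≥ 0 be natural numbers, and fix an index i ∈ {0,…,ℓ}. Let B ⊆ Δ_ℓ(d) be basepoint-free and concise. Let (z_k)_{k≠i} be pairwise distinct elements of Kˣ, and set f_i = y_1 and f_k = y_0 − z_k y_1 for k ≠ i. Then there is no (λ,μ) ∈ K² \ {(0,0)} such that for every v ∈ B, λ·(coefficient of y_0^d in f^v) + μ·(coefficient of y_1^d in f^v) = 0. (Geometrically: the center of the projection defining the rational curve C_{B,f} meets no secant line of the rational normal curve through the marked point P_i = (1:0) and the point corresponding to (0:1), which is not one of the marked points. This is the second assertion of the paper's lemma on marked secants: a secant through P_i met by the center of projection must pass through another marked point P_j.) -/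
/-- `Delta n d` is the set Δ(d) of integer vectors in `ℤ^n` with nonnegative
entries summing to `d`.  (For the paper's Δ_ℓ(d) take `n = ℓ + 1`.) -/
def Delta (n d : ℕ) : Set (Fin n → ℤ) :=
  {u | (∀ i, 0 ≤ u i) ∧ ∑ i, u i = (d : ℤ)}

/-- A subset `B ⊆ ℤ^n` is basepoint-free if for every index `i` there is
`v ∈ B` with `v i = 0`. -/
def Basepointfree {n : ℕ} (B : Set (Fin n → ℤ)) : Prop :=
  ∀ i, ∃ v ∈ B, v i = 0

/-- A subset `B ⊆ ℤ^n` is concise if for every index `i` there is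
`v ∈ B` with `v i ≠ 0`. -/
def Concise {n : ℕ} (B : Set (Fin n → ℤ)) : Prop :=
  ∀ i, ∃ v ∈ B, v i ≠ 0

/-- Given linear forms `f i` in the two variables `y₀ = X 0`, `y₁ = X 1` and an
exponent vector `v` with nonnegative entries, `fpow f v = ∏ i, (f i)^(v i)`. -/
noncomputable def fpow {K : Type*} [CommRing K] {n : ℕ}
    (f : Fin n → MvPolynomial (Fin 2) K) (v : Fin n → ℤ) : MvPolynomial (Fin 2) K :=
  ∏ i, (f i) ^ (v i).toNat

/-- The coefficient of the monomial `y₀^p * y₁^q` in a polynomial in two variables. -/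
noncomputable def coeffMon {K : Type*} [CommRing K] (p q : ℕ)
    (P : MvPolynomial (Fin 2) K) : K :=
  MvPolynomial.coeff (Finsupp.single (0 : Fin 2) p + Finsupp.single (1 : Fin 2) q) P

/-- Evaluating a form of degree `d` at a coordinate point reads off the coefficient of the
corresponding pure power. -/
theorem MvPolynomial.IsHomogeneous.eval_single_one {σ R : Type*} [Fintype σ] [DecidableEq σ]
    [CommSemiring R] {P : MvPolynomial σ R} {d : ℕ} (hP : P.IsHomogeneous d) (j : σ) :
    MvPolynomial.eval (Pi.single j 1) P = MvPolynomial.coeff (Finsupp.single j d) P := by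
  rw [MvPolynomial.eval_eq', Finset.sum_eq_single (Finsupp.single j d)]
  · rw [Finset.prod_eq_one, mul_one]
    intro k _
    rcases eq_or_ne k j with rfl | hk
    · simp
    · simp [Finsupp.single_eq_of_ne hk]
  · intro m hm hne
    obtain ⟨k, hkj, hk⟩ : ∃ k, k ≠ j ∧ m k ≠ 0 := by
      by_contra! h
      have hdeg : m.degree = d := by
        by_contra hd
        exact MvPolynomial.mem_support_iff.mp hm (hP.coeff_eq_zero hd)
      have hmj : m = Finsupp.single j (m j) := by
        ext k
        rcases eq_or_ne k j with rfl | hk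
        · simp
        · simp [Finsupp.single_eq_of_ne hk, h k hk]
      rw [hmj, Finsupp.degree_single] at hdeg
      exact hne (hdeg ▸ hmj)
    rw [Finset.prod_eq_zero (Finset.mem_univ k), mul_zero]
    rw [Pi.single_eq_of_ne hkj, zero_pow hk]
  · intro h
    rw [MvPolynomial.notMem_support_iff.mp h, zero_mul]

theorem isHomogeneous_fpow {K : Type*} [CommRing K] {n d : ℕ}
    {f : Fin n → MvPolynomial (Fin 2) K} (hf : ∀ k, (f k).IsHomogeneous 1)
    {v : Fin n → ℤ} (hv : v ∈ Delta n d) : (fpow f v).IsHomogeneous d := by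
  have hsum : ∑ k, 1 * (v k).toNat = d := by
    zify
    simpa [max_eq_left (hv.1 _)] using hv.2
  rw [← hsum]
  exact MvPolynomial.IsHomogeneous.prod _ _ _ fun k _ => (hf k).pow _

theorem eval_fpow {K : Type*} [CommRing K] {n : ℕ} (f : Fin n → MvPolynomial (Fin 2) K)
    (v : Fin n → ℤ) (x : Fin 2 → K) :
    MvPolynomial.eval x (fpow f v) = ∏ k, MvPolynomial.eval x (f k) ^ (v k).toNat := by
  simp [fpow]

theorem statement_5 (K : Type*) [Field K] (d ℓ : ℕ) (hd : 1 ≤ d)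
    (i : Fin (ℓ + 1))
    (B : Set (Fin (ℓ + 1) → ℤ))
    (hBΔ : B ⊆ Delta (ℓ + 1) d)
    (hbpf : Basepointfree B)
    (hconc : Concise B)
    (z : Fin (ℓ + 1) → K)
    (hz0 : ∀ k, k ≠ i → z k ≠ 0)
    (hdist : ∀ k l, k ≠ i → l ≠ i → k ≠ l → z k ≠ z l)
    (f : Fin (ℓ + 1) → MvPolynomial (Fin 2) K)
    (hfi : f i = MvPolynomial.X 1)
    (hfk : ∀ k, k ≠ i →
      f k = MvPolynomial.X 0 - MvPolynomial.C (z k) * MvPolynomial.X 1) :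
    ¬ ∃ lam mu : K, (lam, mu) ≠ (0, 0) ∧ ∀ v ∈ B,
        lam * coeffMon d 0 (fpow f v) + mu * coeffMon 0 d (fpow f v) = 0 := by
  have hf : ∀ k, (f k).IsHomogeneous 1 := by
    intro k
    rcases eq_or_ne k i with rfl | hk
    · exact hfi ▸ MvPolynomial.isHomogeneous_X K 1
    · rw [hfk k hk]
      refine (MvPolynomial.isHomogeneous_X K 0).sub ?_
      simpa using (MvPolynomial.isHomogeneous_C (Fin 2) (z k)).mul
        (MvPolynomial.isHomogeneous_X K 1)
  have hleft : ∀ v ∈ B, coeffMon d 0 (fpow f v) =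
      ∏ k, MvPolynomial.eval (Pi.single 0 1) (f k) ^ (v k).toNat := by
    intro v hv
    rw [← eval_fpow, (isHomogeneous_fpow hf (hBΔ hv)).eval_single_one]
    simp [coeffMon]
  have hright : ∀ v ∈ B, coeffMon 0 d (fpow f v) =
      ∏ k, MvPolynomial.eval (Pi.single 1 1) (f k) ^ (v k).toNat := by
    intro v hv
    rw [← eval_fpow, (isHomogeneous_fpow hf (hBΔ hv)).eval_single_one]
    simp [coeffMon]
  rintro ⟨lam, mu, hne, h⟩
  have hmu : mu = 0 := by
    obtain ⟨v, hv, hvi⟩ := hconc i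
    have hpos : (v i).toNat ≠ 0 := by
      have := (hBΔ hv).1 i
      omega
    have h0 : coeffMon d 0 (fpow f v) = 0 := by
      rw [hleft v hv]
      refine Finset.prod_eq_zero (Finset.mem_univ i) ?_
      simp [hfi, hpos]
    have h1 : coeffMon 0 d (fpow f v) ≠ 0 := by
      rw [hright v hv]
      refine Finset.prod_ne_zero_iff.mpr fun k _ => pow_ne_zero _ ?_
      rcases eq_or_ne k i with rfl | hk
      · simp [hfi]
      · simp [hfk k hk, hz0 k hk]
    have hv0 := h v hv
    rw [h0, mul_zero, zero_add] at hv0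
    exact (mul_eq_zero.mp hv0).resolve_right h1
  have hlam : lam = 0 := by
    obtain ⟨v, hv, hvi⟩ := hbpf i
    have h1 : coeffMon d 0 (fpow f v) = 1 := by
      rw [hleft v hv]
      refine Finset.prod_eq_one fun k _ => ?_
      rcases eq_or_ne k i with rfl | hk
      · simp [hvi]
      · simp [hfk k hk]
    simpa [h1, hmu] using h v hv
  exact hne (by rw [hlam, hmu])
end

section
/- Let K be a field, let d ≥ 1 and ℓ ≥ 0 be natural numbers, let B ⊆ Δ_ℓ(d) be nonempty, and let z_0,…,z_ℓ be pairwise distinct elements of K. Set f_i = y_1 − z_i y_0 for each i. Then there exists (a,b) ∈ K² \ {(0,0)} such that for every v ∈ B, a·(coefficient of y_1^d in f^v) + b·(coefficient of y_0 y_1^{d−1} in f^v) = 0, if and only if ∑_{i=0}^{ℓ} z_i w_i = 0 for every w ∈ ⟨B⟩. (This computes, in the proof of the lemma on unmarked cusps, the locus V of marked points P_i = (1:z_i) for which the center of the projection defining C_{B,f} meets the tangent line of the rational normal curve at the unmarked point Q = (0:1); V is cut out by the equations z·v = 0 for v ∈ ⟨B⟩.) -/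
/-- `latticeOf B` is the subgroup ⟨B⟩ of `ℤ^n` generated by all differences
of elements of `B`. -/
def latticeOf {n : ℕ} (B : Set (Fin n → ℤ)) : AddSubgroup (Fin n → ℤ) :=
  AddSubgroup.closure {x | ∃ v ∈ B, ∃ w ∈ B, x = v - w}

open MvPolynomial in
/-- Multiplying by a power of `y₁ - a y₀` preserves a first-order expansion along `y₀ = 0`. -/
theorem X_zero_sq_dvd_pow_mul {K : Type*} [CommRing K] {n : ℕ} {c : K}
    {P : MvPolynomial (Fin 2) K}
    (h : (X 0 : MvPolynomial (Fin 2) K) ^ 2 ∣ X 1 * P - (X 1 ^ (n + 1) - C c * (X 0 * X 1 ^ n)))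
    (a : K) (m : ℕ) :
    (X 0 : MvPolynomial (Fin 2) K) ^ 2 ∣ X 1 * ((X 1 - C a * X 0) ^ m * P) -
      (X 1 ^ (m + n + 1) - C (m * a + c) * (X 0 * X 1 ^ (m + n))) := by
  induction m with
  | zero => simpa using h
  | succ m ih =>
    obtain ⟨Q, hQ⟩ := ih
    refine ⟨(X 1 - C a * X 0) * Q + C a * C (m * a + c) * X 1 ^ (m + n), ?_⟩
    have hc : (C ((m + 1 : ℕ) * a + c) : MvPolynomial (Fin 2) K) = C a + C (m * a + c) := by
      rw [← C_add]; congr 1; push_cast; ring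
    rw [hc]
    linear_combination (X 1 - C a * X 0) * hQ

open MvPolynomial in
/-- First-order expansion along `y₀ = 0` of a product of powers of linear forms `y₁ - z i y₀`. -/
theorem X_zero_sq_dvd_prod {K ι : Type*} [CommRing K] (s : Finset ι) (z : ι → K) (m : ι → ℕ) :
    (X 0 : MvPolynomial (Fin 2) K) ^ 2 ∣ X 1 * ∏ i ∈ s, (X 1 - C (z i) * X 0) ^ m i -
      (X 1 ^ (∑ i ∈ s, m i + 1) - C (∑ i ∈ s, m i * z i) * (X 0 * X 1 ^ ∑ i ∈ s, m i)) := by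
  classical
  induction s using Finset.induction_on with
  | empty => simp
  | insert i s hi ih =>
    rw [Finset.prod_insert hi, Finset.sum_insert hi, Finset.sum_insert hi]
    exact X_zero_sq_dvd_pow_mul ih (z i) (m i)

theorem coeffMon_add {K : Type*} [CommRing K] (p q : ℕ) (P Q : MvPolynomial (Fin 2) K) :
    coeffMon p q (P + Q) = coeffMon p q P + coeffMon p q Q :=
  MvPolynomial.coeff_add _ _ _

theorem coeffMon_sub {K : Type*} [CommRing K] (p q : ℕ) (P Q : MvPolynomial (Fin 2) K) :
    coeffMon p q (P - Q) = coeffMon p q P - coeffMon p q Q :=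
  MvPolynomial.coeff_sub _ _ _ _

open MvPolynomial in
theorem coeffMon_X_one_mul {K : Type*} [CommRing K] (p q : ℕ) (P : MvPolynomial (Fin 2) K) :
    coeffMon p (q + 1) (X 1 * P) = coeffMon p q P := by
  rw [coeffMon, Finsupp.single_add, ← add_assoc, add_comm, coeff_X_mul, coeffMon]

open MvPolynomial in
theorem coeffMon_C_mul_X_pow_mul_X_pow {K : Type*} [CommRing K] (p q r s : ℕ) (c : K) :
    coeffMon p q (C c * (X 0 ^ r * X 1 ^ s)) = if r = p ∧ s = q then c else 0 := by
  have h : (Finsupp.single (0 : Fin 2) r + Finsupp.single (1 : Fin 2) s =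
      Finsupp.single 0 p + Finsupp.single 1 q) ↔ r = p ∧ s = q := by
    simp [Finsupp.ext_iff, Fin.forall_fin_two]
  rw [coeffMon, X_pow_eq_monomial, X_pow_eq_monomial, monomial_mul, C_mul_monomial,
    coeff_monomial]
  simp only [h, mul_one]

open MvPolynomial in
theorem coeffMon_X_zero_pow_mul_of_lt {K : Type*} [CommRing K] {p r : ℕ} (hp : p < r) (q : ℕ)
    (P : MvPolynomial (Fin 2) K) : coeffMon p q (X 0 ^ r * P) = 0 := by
  rw [coeffMon, X_pow_eq_monomial, coeff_monomial_mul', if_neg]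
  intro h
  simpa [hp.not_ge] using h 0

open MvPolynomial in
/-- The two lowest coefficients in `y₀` of a product of powers of linear forms `y₁ - z i y₀`. -/
theorem coeffMon_fpow {K : Type*} [CommRing K] {n d : ℕ} (hd : 1 ≤ d) {v : Fin n → ℤ}
    (hv : v ∈ Delta n d) (z : Fin n → K) {f : Fin n → MvPolynomial (Fin 2) K}
    (hf : ∀ i, f i = X 1 - C (z i) * X 0) :
    coeffMon 0 d (fpow f v) = 1 ∧ coeffMon 1 (d - 1) (fpow f v) = -∑ i, z i * (v i : K) := by
  obtain ⟨Q, hQ⟩ := X_zero_sq_dvd_prod Finset.univ z fun i => (v i).toNat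
  have hcast (i : Fin n) : ((v i).toNat : ℤ) = v i := Int.toNat_of_nonneg (hv.1 i)
  have hsum : ∑ i, (v i).toNat = d := by
    zify
    simp only [hcast, hv.2]
  have hlin : ∑ i, ((v i).toNat : K) * z i = ∑ i, z i * (v i : K) := by
    refine Finset.sum_congr rfl fun i _ => ?_
    rw [mul_comm, ← Int.cast_natCast, hcast]
  rw [hsum, hlin] at hQ
  have hP : X 1 * fpow f v = C 1 * (X 0 ^ 0 * X 1 ^ (d + 1)) -
      C (∑ i, z i * (v i : K)) * (X 0 ^ 1 * X 1 ^ d) + X 0 ^ 2 * Q := by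
    simp only [fpow, hf, C_1]
    linear_combination hQ
  refine ⟨?_, ?_⟩
  · rw [← coeffMon_X_one_mul, hP, coeffMon_add, coeffMon_sub, coeffMon_C_mul_X_pow_mul_X_pow,
      coeffMon_C_mul_X_pow_mul_X_pow, coeffMon_X_zero_pow_mul_of_lt (by decide)]
    simp
  · rw [← coeffMon_X_one_mul, Nat.sub_add_cancel hd, hP, coeffMon_add, coeffMon_sub,
      coeffMon_C_mul_X_pow_mul_X_pow, coeffMon_C_mul_X_pow_mul_X_pow,
      coeffMon_X_zero_pow_mul_of_lt (by decide)]
    simp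

/-- A linear form vanishes on `latticeOf B` iff it is constant on `B`. -/
theorem forall_latticeOf_sum_eq_zero_iff {K : Type*} [CommRing K] {n : ℕ}
    (B : Set (Fin n → ℤ)) (z : Fin n → K) :
    (∀ w ∈ latticeOf B, ∑ i, z i * (w i : K) = 0) ↔
      ∀ v ∈ B, ∀ w ∈ B, ∑ i, z i * (v i : K) = ∑ i, z i * (w i : K) := by
  constructor
  · intro h v hv w hw
    have := h (v - w) (AddSubgroup.subset_closure ⟨v, hv, w, hw, rfl⟩)
    simpa [mul_sub, sub_eq_zero] using this
  · intro h w hw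
    induction hw using AddSubgroup.closure_induction with
    | mem x hx =>
      obtain ⟨v, hv, w, hw, rfl⟩ := hx
      simpa [mul_sub, sub_eq_zero] using h v hv w hw
    | zero => simp
    | add x y _ _ hx hy => simp [mul_add, Finset.sum_add_distrib, hx, hy]
    | neg x _ hx => simp [hx]

theorem statement_6 (K : Type*) [Field K] (d ℓ : ℕ) (hd : 1 ≤ d)
    (B : Set (Fin (ℓ + 1) → ℤ))
    (hBΔ : B ⊆ Delta (ℓ + 1) d)
    (hBne : B.Nonempty)
    (z : Fin (ℓ + 1) → K)
    (hdist : ∀ i j, i ≠ j → z i ≠ z j)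
    (f : Fin (ℓ + 1) → MvPolynomial (Fin 2) K)
    (hf : ∀ i, f i = MvPolynomial.X 1 - MvPolynomial.C (z i) * MvPolynomial.X 0) :
    (∃ a b : K, (a, b) ≠ (0, 0) ∧ ∀ v ∈ B,
        a * coeffMon 0 d (fpow f v) + b * coeffMon 1 (d - 1) (fpow f v) = 0) ↔
      (∀ w ∈ latticeOf B, ∑ i, z i * ((w i : ℤ) : K) = 0) := by
  rw [forall_latticeOf_sum_eq_zero_iff]
  have key (v) (hv : v ∈ B) := coeffMon_fpow hd (hBΔ hv) z hf
  constructor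
  · rintro ⟨a, b, hab, h⟩ v hv w hw
    have hv' := h v hv
    have hw' := h w hw
    rw [(key v hv).1, (key v hv).2] at hv'
    rw [(key w hw).1, (key w hw).2] at hw'
    have hb : b ≠ 0 := by
      rintro rfl
      apply hab
      simpa using hv'
    exact mul_left_cancel₀ hb (by linear_combination hw' - hv')
  · intro h
    obtain ⟨u, hu⟩ := hBne
    refine ⟨∑ i, z i * (u i : K), 1, by simp, fun v hv => ?_⟩
    rw [(key v hv).1, (key v hv).2, h v hv u hu]
    ring
end

section
/- Let K be a field, let d ≥ 1 and ℓ ≥ 0 be natural numbers, let B ⊆ Δ_ℓ(d) be nonempty, and let z_0,…,z_ℓ be pairwise distinct elements of Kˣ. Set f_i = y_0 − z_i y_1 for each i. Then there exists (a,b) ∈ K² \ {(0,0)} such that for every v ∈ B, a·(coefficient of y_0^d in f^v) + b·(coefficient of y_1^d in f^v) = 0, if and only if ∏_{i=0}^{ℓ} z_i^{w_i} = 1 for every w ∈ ⟨B⟩ (this product is well defined in Kˣ since each w ∈ ⟨B⟩ has coordinate sum zero). (This computes, in the proof of the lemma on unmarked secants, the locus V of marked points P_i = (z_i:1) for which the center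 of the projection defining C_{B,f} meets the secant line of the rational normal curve through the unmarked points (1:0) and (0:1); V is cut out by the equations z^v = 1 for v ∈ ⟨B⟩.) -/
open MvPolynomial in
/-- Evaluating a form of degree `d` at the `i`-th coordinate point gives the coefficient of the
`d`-th power of the `i`-th variable. -/
theorem MvPolynomial.IsHomogeneous.eval_piSingle {R σ : Type*} [CommSemiring R] [Fintype σ]
    [DecidableEq σ] {P : MvPolynomial σ R} {d : ℕ} (hP : P.IsHomogeneous d) (i : σ) :
    eval (Pi.single i 1) P = coeff (Finsupp.single i d) P := by
  rw [eval_eq']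
  have key : ∀ m ∈ P.support, m ≠ Finsupp.single i d →
      coeff m P * ∏ j, (Pi.single i 1 : σ → R) j ^ m j = 0 := by
    intro m hm hne
    have hdeg : ∑ j, m j = d := by
      have h := hP (mem_support_iff.mp hm)
      rwa [← Finsupp.degree_eq_sum, Finsupp.degree_eq_weight_one]
    obtain ⟨j, hji, hj⟩ : ∃ j, j ≠ i ∧ m j ≠ 0 := by
      by_contra! h
      have hi : m i = d := by rw [← hdeg, Fintype.sum_eq_single i h]
      refine hne (Finsupp.ext fun j => ?_)
      by_cases hji : j = i
      · subst hji; simpa using hi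
      · simp [h j hji, Ne.symm hji]
    rw [Finset.prod_eq_zero (Finset.mem_univ j) (by simp [hji, hj]), mul_zero]
  rw [Finset.sum_eq_single (Finsupp.single i d) key
    (fun h => by rw [notMem_support_iff.mp h, zero_mul])]
  rw [Finset.prod_eq_one, mul_one]
  intro j _
  by_cases hji : j = i
  · subst hji; simp
  · simp [Ne.symm hji]

theorem Delta.sum_toNat {n d : ℕ} {v : Fin n → ℤ} (hv : v ∈ Delta n d) :
    ∑ i, (v i).toNat = d := by
  zify
  rw [← hv.2]
  exact Finset.sum_congr rfl fun i _ => Int.toNat_of_nonneg (hv.1 i)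

theorem fpow_isHomogeneous {K : Type*} [CommRing K] {n d : ℕ} {f : Fin n → MvPolynomial (Fin 2) K}
    (hf : ∀ i, (f i).IsHomogeneous 1) {v : Fin n → ℤ} (hv : v ∈ Delta n d) :
    (fpow f v).IsHomogeneous d := by
  rw [← Delta.sum_toNat hv]
  refine MvPolynomial.IsHomogeneous.prod _ _ _ fun i _ => ?_
  simpa using (hf i).pow (v i).toNat

theorem isHomogeneous_X_sub_C_mul_X {K : Type*} [CommRing K] (c : K) :
    (MvPolynomial.X 0 - MvPolynomial.C c * MvPolynomial.X 1 :
      MvPolynomial (Fin 2) K).IsHomogeneous 1 :=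
  (MvPolynomial.isHomogeneous_X K 0).sub (MvPolynomial.isHomogeneous_C_mul_X c 1)

theorem coeffMon_left_fpow {K : Type*} [Field K] {n d : ℕ} (z : Fin n → K)
    {v : Fin n → ℤ} (hv : v ∈ Delta n d) :
    coeffMon d 0 (fpow (fun i => MvPolynomial.X 0 - MvPolynomial.C (z i) * MvPolynomial.X 1) v)
      = 1 := by
  have h := (fpow_isHomogeneous (fun i => isHomogeneous_X_sub_C_mul_X (z i)) hv).eval_piSingle 0
  rw [coeffMon, Finsupp.single_zero, add_zero, ← h]
  simp [fpow, map_prod]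

theorem coeffMon_right_fpow {K : Type*} [Field K] {n d : ℕ} (z : Fin n → K)
    {v : Fin n → ℤ} (hv : v ∈ Delta n d) :
    coeffMon 0 d (fpow (fun i => MvPolynomial.X 0 - MvPolynomial.C (z i) * MvPolynomial.X 1) v)
      = (-1) ^ d * ∏ i, z i ^ v i := by
  have h := (fpow_isHomogeneous (fun i => isHomogeneous_X_sub_C_mul_X (z i)) hv).eval_piSingle 1
  rw [coeffMon, Finsupp.single_zero, zero_add, ← h, ← Delta.sum_toNat hv,
    ← Finset.prod_pow_eq_pow_sum, ← Finset.prod_mul_distrib, fpow, map_prod]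
  refine Finset.prod_congr rfl fun i _ => ?_
  have hz : z i ^ v i = z i ^ (v i).toNat := by
    rw [← zpow_natCast, Int.toNat_of_nonneg (hv.1 i)]
  rw [hz, ← mul_pow]
  simp

theorem forall_mem_latticeOf_prod_zpow_eq_one_iff {K : Type*} [Field K] {n : ℕ}
    {B : Set (Fin n → ℤ)} {z : Fin n → K} (hz : ∀ i, z i ≠ 0) :
    (∀ w ∈ latticeOf B, ∏ i, z i ^ w i = 1) ↔
      ∀ v ∈ B, ∀ v' ∈ B, ∏ i, z i ^ v i = ∏ i, z i ^ v' i := by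
  have hsub (v w : Fin n → ℤ) :
      ∏ i, z i ^ (v - w) i = (∏ i, z i ^ v i) / ∏ i, z i ^ w i := by
    rw [← Finset.prod_div_distrib]
    exact Finset.prod_congr rfl fun i _ => zpow_sub₀ (hz i) _ _
  have hne (v : Fin n → ℤ) : ∏ i, z i ^ v i ≠ 0 :=
    Finset.prod_ne_zero_iff.mpr fun i _ => zpow_ne_zero _ (hz i)
  constructor
  · intro h v hv v' hv'
    have := h (v - v') (AddSubgroup.subset_closure ⟨v, hv, v', hv', rfl⟩)
    rwa [hsub, div_eq_one_iff_eq (hne v')] at this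
  · intro h w hw
    induction hw using AddSubgroup.closure_induction with
    | mem x hx =>
      obtain ⟨v, hv, v', hv', rfl⟩ := hx
      rw [hsub, div_eq_one_iff_eq (hne v')]
      exact h v hv v' hv'
    | zero => simp
    | add x y _ _ hx hy => simp [zpow_add₀ (hz _), Finset.prod_mul_distrib, hx, hy]
    | neg x _ hx => simp [hx]

theorem statement_7 (K : Type*) [Field K] (d ℓ : ℕ) (hd : 1 ≤ d)
    (B : Set (Fin (ℓ + 1) → ℤ))
    (hBΔ : B ⊆ Delta (ℓ + 1) d)
    (hBne : B.Nonempty)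
    (z : Fin (ℓ + 1) → K)
    (hz0 : ∀ i, z i ≠ 0)
    (hdist : ∀ i j, i ≠ j → z i ≠ z j)
    (f : Fin (ℓ + 1) → MvPolynomial (Fin 2) K)
    (hf : ∀ i, f i = MvPolynomial.X 0 - MvPolynomial.C (z i) * MvPolynomial.X 1) :
    (∃ a b : K, (a, b) ≠ (0, 0) ∧ ∀ v ∈ B,
        a * coeffMon d 0 (fpow f v) + b * coeffMon 0 d (fpow f v) = 0) ↔
      (∀ w ∈ latticeOf B, ∏ i, z i ^ (w i) = 1) := by
  obtain rfl : f = fun i => MvPolynomial.X 0 - MvPolynomial.C (z i) * MvPolynomial.X 1 :=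
    funext hf
  rw [forall_mem_latticeOf_prod_zpow_eq_one_iff hz0]
  have hsign : ((-1 : K)) ^ d ≠ 0 := pow_ne_zero _ (neg_ne_zero.mpr one_ne_zero)
  constructor
  · rintro ⟨a, b, hab, h⟩ v hv v' hv'
    have h₁ := h v hv
    have h₂ := h v' hv'
    rw [coeffMon_left_fpow z (hBΔ hv), coeffMon_right_fpow z (hBΔ hv)] at h₁
    rw [coeffMon_left_fpow z (hBΔ hv'), coeffMon_right_fpow z (hBΔ hv')] at h₂
    have hb : b ≠ 0 := by
      rintro rfl
      exact hab (by simpa using h₁)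
    exact mul_left_cancel₀ hsign (mul_left_cancel₀ hb (add_left_cancel (h₁.trans h₂.symm)))
  · intro h
    obtain ⟨v₀, hv₀⟩ := hBne
    refine ⟨-((-1) ^ d * ∏ i, z i ^ v₀ i), 1, by simp, fun v hv => ?_⟩
    rw [coeffMon_left_fpow z (hBΔ hv), coeffMon_right_fpow z (hBΔ hv), h v hv v₀ hv₀]
    ring
end

section
/- Let K be an algebraically closed field of characteristic zero, let d ≥ 1 and ℓ ≥ 2, and let B ⊆ Δ_ℓ(d) be basepoint-free and concise such that Λ := ⟨B⟩ has rank 2 and e_i − e_j ∉ Λ for all i ≠ j. Assume Λ satisfies the secant condition over K. Then there exist a natural number d′ ≤ 3 and a basepoint-free, concise subset B′ ⊆ Δ_ℓ(d′) with exactly three elements such that ⟨B′⟩ = Λ. -/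
/-- `Λ` satisfies the secant condition over `K` if for every point `z` of the
quasitorus `Y(Λ) = {z ∈ (Kˣ)^n : z^v = 1 ∀ v ∈ Λ}` there is
`(a,b) ≠ (0,0)` such that the vector `(a zᵢ + b zᵢ⁻¹)ᵢ` lies in `Λ^⊥_K`. -/
def SecantCondition (K : Type*) [Field K] {n : ℕ} (Λ : AddSubgroup (Fin n → ℤ)) : Prop :=
  ∀ z : Fin n → K, (∀ i, z i ≠ 0) → (∀ v ∈ Λ, ∏ i, z i ^ (v i) = 1) →
    ∃ a b : K, (a, b) ≠ (0, 0) ∧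
      ∀ v ∈ Λ, ∑ i, (a * z i + b * (z i)⁻¹) * ((v i : ℤ) : K) = 0


theorem exists_unit_ne_one_pow_eq_one (K : Type*) [Field K] [IsAlgClosed K] [CharZero K]
    {m : ℕ} (hm : m ≠ 1) : ∃ t : Kˣ, t ≠ 1 ∧ t ^ m = 1 := by
  rcases eq_or_ne m 0 with rfl | h0
  · refine ⟨-1, fun h => ?_, pow_zero _⟩
    exact Ring.neg_one_ne_one_of_char_ne_two (R := K) (by simp [ringChar.eq_zero])
      (congrArg Units.val h)
  · have : NeZero (m : K) := ⟨Nat.cast_ne_zero.2 h0⟩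
    obtain ⟨ζ, hζ⟩ := HasEnoughRootsOfUnity.exists_primitiveRoot K m
    have hu := hζ.isUnit h0
    refine ⟨hu.unit, fun h => hζ.ne_one (by omega) (congrArg Units.val h), ?_⟩
    ext
    simpa using hζ.pow_eq_one

theorem exists_addMonoidHom_units_ne_zero (K : Type*) [Field K] [IsAlgClosed K] [CharZero K]
    {A : Type*} [AddCommGroup A] {a : A} (ha : a ≠ 0) :
    ∃ φ : A →+ Additive Kˣ, φ a ≠ 0 := by
  obtain ⟨t, ht1, ht⟩ := exists_unit_ne_one_pow_eq_one K
    (m := addOrderOf a) (by simpa [AddMonoid.addOrderOf_eq_one_iff] using ha)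
  let g : (ℤ ⧸ Ideal.span {(addOrderOf a : ℤ)}) →ₗ[ℤ] Additive Kˣ :=
    Submodule.liftQSpanSingleton _ (LinearMap.toSpanSingleton ℤ (Additive Kˣ) (Additive.ofMul t))
      (by
        rw [LinearMap.toSpanSingleton_apply, natCast_zsmul, ← ofMul_pow, ht, ofMul_one])
  let f : (ℤ ∙ a) →ₗ[ℤ] Additive Kˣ :=
    g ∘ₗ (CharacterModule.intSpanEquivQuotAddOrderOf a).toLinearMap
  have hf : f ⟨a, Submodule.mem_span_singleton_self a⟩ = Additive.ofMul t := by
    simp only [f, LinearMap.comp_apply, LinearEquiv.coe_coe]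
    rw [CharacterModule.intSpanEquivQuotAddOrderOf_apply_self]
    simp only [g]
    erw [Submodule.liftQSpanSingleton_apply]
    exact one_zsmul _
  have hroot : ∀ {n : ℕ}, n ≠ 0 → Function.Surjective fun u : Kˣ => u ^ n := by
    intro n hn u
    obtain ⟨z, hz⟩ := IsAlgClosed.exists_pow_nat_eq (u : K) (Nat.pos_of_ne_zero hn)
    have hz0 : z ≠ 0 := by
      rintro rfl
      rw [zero_pow hn] at hz
      exact u.ne_zero hz.symm
    exact ⟨Units.mk0 z hz0, by ext; simpa using hz⟩
  let _ : DivisibleBy (Additive Kˣ) ℕ :=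
    divisibleByOfSMulRightSurj _ _ fun {n} hn u => hroot hn u.toMul
  let _ : DivisibleBy (Additive Kˣ) ℤ := AddGroup.divisibleByIntOfDivisibleByNat _
  obtain ⟨φ, hφ⟩ := (Module.Baer.of_divisible (Additive Kˣ)).extension_property
    (Submodule.subtype (ℤ ∙ a)) (Submodule.injective_subtype _) f
  refine ⟨φ.toAddMonoidHom, fun h => ht1 ?_⟩
  have := LinearMap.congr_fun hφ ⟨a, Submodule.mem_span_singleton_self a⟩
  rw [hf] at this
  exact congrArg Additive.toMul (this.symm.trans h)

/-- The quasitorus of a lattice. -/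
def quasitorus (K : Type*) [Field K] {n : ℕ} (Λ : AddSubgroup (Fin n → ℤ)) :
    Subgroup (Fin n → Kˣ) where
  carrier := {z | ∀ v ∈ Λ, ∏ i, z i ^ v i = 1}
  one_mem' := by simp
  mul_mem' := fun {x y} hx hy v hv => by
    simp [mul_zpow, Finset.prod_mul_distrib, hx v hv, hy v hv]
  inv_mem' := fun {x} hx v hv => by simp [hx v hv]

theorem mem_of_forall_quasitorus (K : Type*) [Field K] [IsAlgClosed K] [CharZero K] {n : ℕ}
    {Λ : AddSubgroup (Fin n → ℤ)} {u : Fin n → ℤ}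
    (h : ∀ z ∈ quasitorus K Λ, ∏ i, z i ^ u i = 1) : u ∈ Λ := by
  by_contra hu
  obtain ⟨φ, hφ⟩ := exists_addMonoidHom_units_ne_zero K
    (a := (QuotientAddGroup.mk' Λ u)) (by simpa using hu)
  have key : ∀ v : Fin n → ℤ,
      ∏ i, (φ (QuotientAddGroup.mk' Λ (Pi.single i 1))).toMul ^ v i
        = (φ (QuotientAddGroup.mk' Λ v)).toMul := by
    intro v
    conv_rhs => rw [pi_eq_sum_univ' v]
    simp only [map_sum, map_zsmul, toMul_sum, toMul_zsmul]
  refine hφ ?_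
  have := h (fun i => (φ (QuotientAddGroup.mk' Λ (Pi.single i 1))).toMul) (fun v hv => by
    rw [key, QuotientAddGroup.mk'_apply, (QuotientAddGroup.eq_zero_iff v).2 hv]; simp)
  rw [key] at this
  exact congrArg Additive.ofMul this

/-- The character `z ↦ zᵢ / zⱼ` of the quasitorus. -/
def ratioCharacter (K : Type*) [Field K] {n : ℕ} (Λ : AddSubgroup (Fin n → ℤ)) (i j : Fin n) :
    quasitorus K Λ →* K where
  toFun z := ((z : Fin n → Kˣ) i : K) * (((z : Fin n → Kˣ) j : K))⁻¹
  map_one' := by simp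
  map_mul' x y := by simp; ring

theorem sum_ratioCharacter_eq_zero {K : Type*} [Field K] {n : ℕ} {Λ : AddSubgroup (Fin n → ℤ)}
    (hsec : SecantCondition K Λ) {v w : Fin n → ℤ} (hv : v ∈ Λ) (hw : w ∈ Λ)
    (z : quasitorus K Λ) :
    ∑ x : Fin n × Fin n, ((v x.1 * w x.2 - v x.2 * w x.1 : ℤ) : K) *
      ratioCharacter K Λ x.1 x.2 z = 0 := by
  obtain ⟨a, b, hab, h⟩ := hsec (fun i => ((z : Fin n → Kˣ) i : K)) (fun i => by simp)
    (fun v hv => by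
      have := congrArg Units.val (z.2 v hv)
      simpa using this)
  have hv' := h v hv
  have hw' := h w hw
  simp only [add_mul, Finset.sum_add_distrib, mul_assoc, ← Finset.mul_sum] at hv' hw'
  rw [Fintype.sum_prod_type]
  simp only [ratioCharacter, MonoidHom.coe_mk, OneHom.coe_mk]
  set f : Fin n → K := fun i => ((z : Fin n → Kˣ) i : K)
  have expand : ∑ i, ∑ j, ((v i * w j - v j * w i : ℤ) : K) * (f i * (f j)⁻¹)
      = (∑ i, f i * (v i : K)) * (∑ j, (f j)⁻¹ * (w j : K))
        - (∑ i, f i * (w i : K)) * (∑ j, (f j)⁻¹ * (v j : K)) := by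
    simp only [Finset.sum_mul_sum, ← Finset.sum_sub_distrib]
    refine Finset.sum_congr rfl fun i _ => Finset.sum_congr rfl fun j _ => ?_
    push_cast
    ring
  rw [expand]
  by_contra hne
  refine hab (Prod.ext ?_ ?_)
  · refine (mul_eq_zero.1 ?_).resolve_right hne
    linear_combination (∑ j, (f j)⁻¹ * (w j : K)) * hv' - (∑ j, (f j)⁻¹ * (v j : K)) * hw'
  · refine (mul_eq_zero.1 ?_).resolve_right hne
    linear_combination (∑ j, f j * (v j : K)) * hw' - (∑ j, f j * (w j : K)) * hv'

theorem exists_relation {K : Type*} [Field K] [IsAlgClosed K] [CharZero K] {n : ℕ}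
    {Λ : AddSubgroup (Fin n → ℤ)} (hsec : SecantCondition K Λ) {v w : Fin n → ℤ}
    (hv : v ∈ Λ) (hw : w ∈ Λ) {i j : Fin n} (hij : v i * w j ≠ v j * w i) :
    ∃ k l, (k, l) ≠ (i, j) ∧
      (Pi.single i 1 - Pi.single j 1 - Pi.single k 1 + Pi.single l 1 : Fin n → ℤ) ∈ Λ := by
  classical
  let χ : Fin n × Fin n → (quasitorus K Λ →* K) := fun x => ratioCharacter K Λ x.1 x.2
  let D : Fin n × Fin n → K := fun x => ((v x.1 * w x.2 - v x.2 * w x.1 : ℤ) : K)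
  obtain ⟨x, hx, hχ⟩ : ∃ x ≠ (i, j), χ x = χ (i, j) := by
    by_contra! hno
    have hli := linearIndependent_monoidHom (quasitorus K Λ) K
    rw [linearIndependent_iff] at hli
    have := hli (∑ x, Finsupp.single (χ x) (D x)) (by
      rw [map_sum]
      ext z
      simp only [Finsupp.linearCombination_single, Finset.sum_apply, Pi.smul_apply, smul_eq_mul]
      exact sum_ratioCharacter_eq_zero hsec hv hw z)
    have := DFunLike.congr_fun this (χ (i, j))
    rw [Finsupp.finsetSum_apply, Finset.sum_eq_single (i, j)] at this
    · simp only [Finsupp.single_eq_same, Finsupp.coe_zero, Pi.zero_apply, D,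
        Int.cast_eq_zero] at this
      exact hij (sub_eq_zero.1 this)
    · intro x _ hx
      exact Finsupp.single_eq_of_ne' (hno x hx)
    · simp
  refine ⟨x.1, x.2, hx, mem_of_forall_quasitorus K fun z hz => ?_⟩
  have h := DFunLike.congr_fun hχ ⟨z, hz⟩
  have h' : z x.1 * (z x.2)⁻¹ = z i * (z j)⁻¹ := by
    ext
    simpa [χ, ratioCharacter] using h
  have hs : ∀ k, ∏ m, z m ^ (Pi.single k 1 : Fin n → ℤ) m = z k := by
    intro k
    rw [Finset.prod_eq_single k] <;> simp +contextual
  simp only [Pi.add_apply, Pi.sub_apply, zpow_add, zpow_sub, Finset.prod_mul_distrib,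
    Finset.prod_inv_distrib, hs]
  rw [← h', mul_right_comm, inv_mul_cancel_right, mul_inv_cancel]

theorem exists_generating_pair {n : ℕ} {Λ : AddSubgroup (Fin n → ℤ)}
    (hrank : Module.finrank ℤ (AddSubgroup.toIntSubmodule Λ) = 2) :
    ∃ b ∈ Λ, ∃ c ∈ Λ, (∃ i j, b i * c j ≠ b j * c i) ∧
      ∀ w ∈ Λ, ∃ x y : ℤ, w = x • b + y • c := by
  let e := Module.finBasisOfFinrankEq ℤ (AddSubgroup.toIntSubmodule Λ) hrank
  refine ⟨e 0, (e 0).2, e 1, (e 1).2, ?_, fun w hw => ?_⟩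
  · by_contra! h
    have hli := Fintype.linearIndependent_iff.1 e.linearIndependent
    have h0 : ∀ i, (e 0 : Fin n → ℤ) i = 0 := fun i => by
      have := hli ![(e 1 : Fin n → ℤ) i, -(e 0 : Fin n → ℤ) i] (by
        refine Subtype.ext (funext fun j => ?_)
        have := h i j
        rw [Fin.sum_univ_two]
        change (e 1 : Fin n → ℤ) i * (e 0 : Fin n → ℤ) j
          + -(e 0 : Fin n → ℤ) i * (e 1 : Fin n → ℤ) j = 0
        linarith) 1
      simpa using this
    exact e.ne_zero 0 (by ext i; exact h0 i)
  · refine ⟨e.repr ⟨w, hw⟩ 0, e.repr ⟨w, hw⟩ 1, ?_⟩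
    have := congrArg Subtype.val (e.sum_repr ⟨w, hw⟩)
    rw [Fin.sum_univ_two] at this
    exact this.symm

theorem exists_pos_neg_of_sum_eq_zero {n : ℕ} {v : Fin n → ℤ} (hv : ∑ i, v i = 0) (h0 : v ≠ 0) :
    ∃ i j, 0 < v i ∧ v j < 0 := by
  obtain ⟨i, hi⟩ := Function.ne_iff.1 h0
  obtain ⟨j, -, hj⟩ := Finset.exists_pos_of_sum_zero_of_exists_nonzero v hv ⟨i, by simp, hi⟩
  obtain ⟨k, -, hk⟩ := Finset.exists_pos_of_sum_zero_of_exists_nonzero (fun i => -v i)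
    (by simpa using hv) ⟨i, Finset.mem_univ _, by simpa using hi⟩
  exact ⟨j, k, hj, by simpa using hk⟩

theorem two_le_sum_abs {n : ℕ} {v : Fin n → ℤ} (hv : ∑ i, v i = 0) (h0 : v ≠ 0) :
    2 ≤ ∑ i, |v i| := by
  obtain ⟨i, j, hi, hj⟩ := exists_pos_neg_of_sum_eq_zero hv h0
  have hij : i ≠ j := by rintro rfl; omega
  calc 2 ≤ |v i| + |v j| := by rw [abs_of_pos hi, abs_of_neg hj]; omega
    _ = ∑ k ∈ {i, j}, |v k| := (Finset.sum_pair (f := fun k => |v k|) hij).symm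
    _ ≤ _ := Finset.sum_le_univ_sum_of_nonneg fun _ => abs_nonneg _

theorem four_le_sum_abs {n : ℕ} {v : Fin n → ℤ} (hv : ∑ i, v i = 0) (h0 : v ≠ 0)
    (hne : ∀ i j, i ≠ j → v ≠ Pi.single i 1 - Pi.single j 1) :
    4 ≤ ∑ i, |v i| := by
  obtain ⟨i, j, hi, hj⟩ := exists_pos_neg_of_sum_eq_zero hv h0
  have hij : i ≠ j := by rintro rfl; omega
  have h2 : 2 ≤ ∑ k, |(v - (Pi.single i 1 - Pi.single j 1) : Fin n → ℤ) k| :=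
    two_le_sum_abs (by simp [hv]) (sub_ne_zero.2 (hne i j hij))
  have : ∑ k, |(v - (Pi.single i 1 - Pi.single j 1) : Fin n → ℤ) k| + 2 = ∑ k, |v k| := by
    have hs : (2 : ℤ) = ∑ k, ((Pi.single i 1 : Fin n → ℤ) k + (Pi.single j 1 : Fin n → ℤ) k) := by
      simp [Finset.sum_add_distrib]
    rw [hs, ← Finset.sum_add_distrib]
    refine Finset.sum_congr rfl fun k _ => ?_
    simp only [Pi.sub_apply, Pi.single_apply]
    split_ifs with h1 h2 h2 <;> subst_vars <;> first | exact absurd rfl hij | grind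
  linarith

/-- The vectors of `Λ` of minimal `ℓ¹` norm, when `Λ` consists of vectors of sum zero and
contains no `eᵢ - eⱼ`. -/
def shortVectors {n : ℕ} (Λ : AddSubgroup (Fin n → ℤ)) : Set (Fin n → ℤ) :=
  {v | v ∈ Λ ∧ ∑ i, |v i| = 4}

theorem neg_mem_shortVectors {n : ℕ} {Λ : AddSubgroup (Fin n → ℤ)} {v : Fin n → ℤ}
    (hv : v ∈ shortVectors Λ) : -v ∈ shortVectors Λ :=
  ⟨neg_mem hv.1, by simpa using hv.2⟩

theorem mem_shortVectors_of_sum_abs_le {n : ℕ} {Λ : AddSubgroup (Fin n → ℤ)}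
    (hsum : ∀ v ∈ Λ, ∑ i, v i = 0)
    (hne : ∀ i j, i ≠ j → (Pi.single i 1 - Pi.single j 1 : Fin n → ℤ) ∉ Λ) {v : Fin n → ℤ}
    (hv : v ∈ Λ) (h0 : v ≠ 0) (hle : ∑ i, |v i| ≤ 4) : v ∈ shortVectors Λ :=
  ⟨hv, hle.antisymm
    (four_le_sum_abs (hsum v hv) h0 fun i j hij h => hne i j hij (h ▸ hv))⟩

/-- If `p, q` are independent short vectors and `w` lies in `Λ` outside their span, then
`w` is congruent to `(p + q) / 2` modulo their span. -/
theorem exists_two_smul_eq {n : ℕ} {Λ : AddSubgroup (Fin n → ℤ)}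
    (hshort : ∀ v ∈ Λ, v ≠ 0 → 4 ≤ ∑ i, |v i|) {p q w : Fin n → ℤ} {N a b : ℤ} (hN : N ≠ 0)
    (hp : p ∈ shortVectors Λ) (hq : q ∈ shortVectors Λ) (hw : w ∈ Λ)
    (hab : N • w = a • p + b • q) :
    (∃ x y : ℤ, w = x • p + y • q) ∨ (∃ x y : ℤ, 2 • (w - x • p - y • q) = p + q) := by
  have round : ∀ c : ℤ, ∃ x, 2 * |c - x * N| ≤ |N| := by
    intro c
    refine ⟨Int.bdiv c N.natAbs * N.sign, ?_⟩
    have h1 := Int.bmod_add_bdiv c N.natAbs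
    have h2 : ((N.natAbs : ℤ)) = N.sign * N := by rw [Int.sign_mul_self_eq_natAbs]
    have hpos : 0 < N.natAbs := Int.natAbs_pos.2 hN
    have h3 := Int.le_bmod (x := c) hpos
    have h4 := Int.bmod_le (x := c) hpos
    have : c - Int.bdiv c N.natAbs * N.sign * N = Int.bmod c N.natAbs := by
      rw [mul_assoc, ← h2]; linarith
    rw [this, ← Int.natCast_natAbs N]
    grind
  obtain ⟨x, hx⟩ := round a
  obtain ⟨y, hy⟩ := round b
  set a' := a - x * N
  set b' := b - y * N
  set u := w - x • p - y • q with hu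
  have huΛ : u ∈ Λ := sub_mem (sub_mem hw (zsmul_mem hp.1 x)) (zsmul_mem hq.1 y)
  have hNu : N • u = a' • p + b' • q := by
    rw [hu, smul_sub, smul_sub, hab]
    simp only [a', b', sub_smul, smul_smul, mul_comm N]
    abel
  by_cases hu0 : u = 0
  · left
    refine ⟨x, y, ?_⟩
    rw [hu, sub_sub, sub_eq_zero] at hu0
    exact hu0
  right
  have h4 := hshort u huΛ hu0
  have hle : |N| * ∑ i, |u i| ≤ |a'| * 4 + |b'| * 4 := by
    nth_rw 1 [← hp.2]
    rw [← hq.2, Finset.mul_sum, Finset.mul_sum, Finset.mul_sum, ← Finset.sum_add_distrib]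
    refine Finset.sum_le_sum fun i _ => ?_
    have := congrFun hNu i
    simp only [Pi.smul_apply, Pi.add_apply, smul_eq_mul] at this
    rw [← abs_mul, this, ← abs_mul, ← abs_mul]
    exact abs_add_le _ _
  have hNpos : 0 < |N| := abs_pos.2 hN
  have ha : 2 * |a'| = |N| := by nlinarith
  have hb : 2 * |b'| = |N| := by nlinarith
  have hsgn : ∀ c : ℤ, 2 * |c| = |N| → ∃ t : ℤ, 2 * c = N + 2 * (t * N) := by
    intro c hc
    rw [show (2 : ℤ) * |c| = |2 * c| by rw [abs_mul]; rfl] at hc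
    rcases abs_eq_abs.1 hc with h | h
    · exact ⟨0, by linarith⟩
    · exact ⟨-1, by linarith⟩
  obtain ⟨s, hs⟩ := hsgn a' ha
  obtain ⟨t, ht⟩ := hsgn b' hb
  refine ⟨x + s, y + t, ?_⟩
  ext i
  have h := congrFun hNu i
  simp only [hu, Pi.smul_apply, Pi.add_apply, Pi.sub_apply, smul_eq_mul, nsmul_eq_mul] at h ⊢
  push_cast
  refine mul_left_cancel₀ hN ?_
  linear_combination 2 * h + p i * hs + q i * ht

theorem exists_short_generating_pair {n : ℕ} {Λ : AddSubgroup (Fin n → ℤ)}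
    (hrank : Module.finrank ℤ (AddSubgroup.toIntSubmodule Λ) = 2)
    (hshort : ∀ v ∈ Λ, v ≠ 0 → 4 ≤ ∑ i, |v i|) {p q : Fin n → ℤ}
    (hp : p ∈ shortVectors Λ) (hq : q ∈ shortVectors Λ) {i j : Fin n}
    (hpq : p i * q j ≠ p j * q i) :
    ∃ p ∈ shortVectors Λ, ∃ q ∈ shortVectors Λ, (∃ i j, p i * q j ≠ p j * q i) ∧
      ∀ w ∈ Λ, ∃ x y : ℤ, w = x • p + y • q := by
  obtain ⟨b, hb, c, hc, -, hspan⟩ := exists_generating_pair hrank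
  have cramer : ∀ w ∈ Λ, (p i * q j - p j * q i) • w
      = (w i * q j - w j * q i) • p + (p i * w j - p j * w i) • q := by
    intro w hw
    obtain ⟨x, y, rfl⟩ := hspan w hw
    obtain ⟨x₁, y₁, rfl⟩ := hspan p hp.1
    obtain ⟨x₂, y₂, rfl⟩ := hspan q hq.1
    ext k
    simp only [Pi.smul_apply, Pi.add_apply, smul_eq_mul]
    ring
  by_cases hall : ∀ w ∈ Λ, ∃ x y : ℤ, w = x • p + y • q
  · exact ⟨p, hp, q, hq, ⟨i, j, hpq⟩, hall⟩
  push Not at hall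
  obtain ⟨w, hw, hwn⟩ := hall
  obtain ⟨x, y, hxy⟩ := (exists_two_smul_eq hshort (sub_ne_zero.2 hpq) hp hq hw
    (cramer w hw)).resolve_left (fun ⟨x, y, h⟩ => hwn x y h)
  set h := w - x • p - y • q
  have hh : ∀ k, 2 * h k = p k + q k := fun k => by simpa using congrFun hxy k
  have hhΛ : h ∈ Λ := sub_mem (sub_mem hw (zsmul_mem hp.1 x)) (zsmul_mem hq.1 y)
  have hind : p i * h j ≠ p j * h i := fun e =>
    hpq (by linear_combination 2 * e - p i * hh j + p j * hh i)
  have hh0 : h ≠ 0 := fun e => hind (by simp [e])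
  have hq' : q = (2 : ℤ) • h - p := by
    ext k
    have := hh k
    simp only [Pi.sub_apply, Pi.smul_apply, smul_eq_mul]
    linarith
  refine ⟨p, hp, h, ⟨hhΛ, le_antisymm ?_ (hshort h hhΛ hh0)⟩, ⟨i, j, hind⟩, fun u hu => ?_⟩
  · have : 2 * ∑ k, |h k| ≤ ∑ k, |p k| + ∑ k, |q k| := by
      rw [Finset.mul_sum, ← Finset.sum_add_distrib]
      refine Finset.sum_le_sum fun k _ => ?_
      have := hh k
      grind
    rw [hp.2, hq.2] at this
    linarith
  · rcases exists_two_smul_eq hshort (sub_ne_zero.2 hpq) hp hq hu (cramer u hu) with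
      ⟨s, t, hst⟩ | ⟨s, t, hst⟩
    · refine ⟨s - t, 2 * t, ?_⟩
      rw [hst, hq']
      module
    · have : u = s • p + t • q + h := by
        ext k
        have h1 := congrFun hst k
        have h2 := hh k
        simp only [Pi.smul_apply, Pi.sub_apply, Pi.add_apply, smul_eq_mul, nsmul_eq_mul] at h1 ⊢
        push_cast at h1
        linarith
      refine ⟨s - t, 2 * t + 1, ?_⟩
      rw [this, hq']
      module

theorem exists_shortVector_pos_neg {K : Type*} [Field K] [IsAlgClosed K] [CharZero K] {n : ℕ}
    {Λ : AddSubgroup (Fin n → ℤ)} (hsec : SecantCondition K Λ)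
    (hsum : ∀ v ∈ Λ, ∑ i, v i = 0)
    (hne : ∀ i j, i ≠ j → (Pi.single i 1 - Pi.single j 1 : Fin n → ℤ) ∉ Λ) {v w : Fin n → ℤ}
    (hv : v ∈ Λ) (hw : w ∈ Λ) {i j : Fin n} (hij : v i * w j ≠ v j * w i) :
    ∃ r ∈ shortVectors Λ, 0 < r i ∧ r j < 0 := by
  obtain ⟨k, l, hkl, hr⟩ := exists_relation hsec hv hw hij
  have hij' : i ≠ j := by rintro rfl; exact hij rfl
  have hki : k ≠ i := by
    rintro rfl
    refine hne l j (fun h => hkl (by rw [h])) ?_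
    convert hr using 1
    abel
  have hlj : l ≠ j := by
    rintro rfl
    refine hne i k hki.symm ?_
    convert hr using 1
    abel
  set r : Fin n → ℤ := Pi.single i 1 - Pi.single j 1 - Pi.single k 1 + Pi.single l 1 with hr_def
  have hri : 0 < r i := by
    simp only [hr_def, Pi.add_apply, Pi.sub_apply, Pi.single_apply, if_neg hki.symm, if_neg hij']
    split_ifs <;> simp
  have hrj : r j < 0 := by
    simp only [hr_def, Pi.add_apply, Pi.sub_apply, Pi.single_apply, if_neg hlj.symm,
      if_neg hij'.symm]
    split_ifs <;> simp
  refine ⟨r, mem_shortVectors_of_sum_abs_le hsum hne hr (fun h => by simp [h] at hri) ?_,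
    hri, hrj⟩
  have h4 : (4 : ℤ) = ∑ m, ((Pi.single i 1 : Fin n → ℤ) m + (Pi.single j 1 : Fin n → ℤ) m
      + (Pi.single k 1 : Fin n → ℤ) m + (Pi.single l 1 : Fin n → ℤ) m) := by
    simp [Finset.sum_add_distrib]
  rw [h4]
  refine Finset.sum_le_sum fun m _ => ?_
  have hnonneg : ∀ t, 0 ≤ (Pi.single t 1 : Fin n → ℤ) m := fun t => by
    rw [Pi.single_apply]; split_ifs <;> simp
  have h1 := hnonneg i
  have h2 := hnonneg j
  have h3 := hnonneg k
  have h5 := hnonneg l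
  simp only [hr_def, Pi.add_apply, Pi.sub_apply]
  rw [abs_le]
  constructor <;> linarith

theorem exists_independent_shortVectors {K : Type*} [Field K] [IsAlgClosed K] [CharZero K] {n : ℕ}
    {Λ : AddSubgroup (Fin n → ℤ)} (hsec : SecantCondition K Λ)
    (hrank : Module.finrank ℤ (AddSubgroup.toIntSubmodule Λ) = 2)
    (hsum : ∀ v ∈ Λ, ∑ i, v i = 0)
    (hne : ∀ i j, i ≠ j → (Pi.single i 1 - Pi.single j 1 : Fin n → ℤ) ∉ Λ) :
    ∃ p ∈ shortVectors Λ, ∃ q ∈ shortVectors Λ, ∃ i j, p i * q j ≠ p j * q i := by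
  by_contra! hpar
  obtain ⟨b, hb, c, hc, ⟨i, j, hbc⟩, -⟩ := exists_generating_pair hrank
  obtain ⟨p, hp, hpi, hpj⟩ := exists_shortVector_pos_neg hsec hsum hne hb hc hbc
  have hexists : ∃ w ∈ Λ, ∃ i j, p i * w j ≠ p j * w i := by
    by_contra! h
    refine hbc (mul_left_cancel₀ hpi.ne' ?_)
    linear_combination b i * h c hc i j - c i * h b hb i j
  obtain ⟨w, hw, i, j, hpw⟩ := hexists
  have hsigns : ∃ i j, 0 < p i ∧ p j < 0 ∧ p i * w j ≠ p j * w i := by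
    obtain ⟨r, hr, hri, hrj⟩ := exists_shortVector_pos_neg hsec hsum hne hp.1 hw hpw
    have h := hpar p hp r hr i j
    rcases lt_trichotomy (p i) 0 with hi | hi | hi
    · exact ⟨j, i, by nlinarith, hi, hpw.symm⟩
    · have hj : p j = 0 := by
        rw [hi, zero_mul] at h
        exact (mul_eq_zero.1 h.symm).resolve_right hri.ne'
      simp [hi, hj] at hpw
    · exact ⟨i, j, hi, by nlinarith, hpw⟩
  obtain ⟨i, j, hpi, hpj, hpw⟩ := hsigns
  have hcol : ∀ m, (p m * w j - p j * w m) * p i = max (p m) 0 * (p i * w j - p j * w i) := by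
    intro m
    rcases le_or_gt (p m) 0 with hm | hm
    · rw [max_eq_right hm, zero_mul]
      by_contra hne0
      have hmj : p m * w j ≠ p j * w m := fun h => hne0 (by rw [h, sub_self, zero_mul])
      obtain ⟨r, hr, hrm, hrj⟩ := exists_shortVector_pos_neg hsec hsum hne hp.1 hw hmj
      have := hpar p hp r hr m j
      nlinarith
    · rw [max_eq_left hm.le]
      have him : p i * w m = p m * w i := by
        by_contra him
        obtain ⟨r, hr, hri, hrm⟩ := exists_shortVector_pos_neg hsec hsum hne hp.1 hw him
        have := hpar p hp r hr i m
        nlinarith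
      linear_combination -p j * him
  have hzero : (∑ m, max (p m) 0) * (p i * w j - p j * w i) = 0 := by
    rw [Finset.sum_mul, ← Finset.sum_congr rfl fun m _ => hcol m, ← Finset.sum_mul,
      Finset.sum_sub_distrib, ← Finset.sum_mul, ← Finset.mul_sum, hsum p hp.1, hsum w hw]
    simp
  have hpos : 0 < ∑ m, max (p m) 0 :=
    Finset.sum_pos' (fun _ _ => le_max_right _ _) ⟨i, Finset.mem_univ _, lt_max_of_lt_left hpi⟩
  exact (mul_ne_zero hpos.ne' (sub_ne_zero.2 hpw)) hzero

theorem exists_ne_zero_and_ne_zero {K : Type*} [Field K] [IsAlgClosed K] [CharZero K] {n : ℕ}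
    {Λ : AddSubgroup (Fin n → ℤ)} (hsec : SecantCondition K Λ)
    (hsum : ∀ v ∈ Λ, ∑ i, v i = 0)
    (hne : ∀ i j, i ≠ j → (Pi.single i 1 - Pi.single j 1 : Fin n → ℤ) ∉ Λ) {p q : Fin n → ℤ}
    (hp : p ∈ shortVectors Λ) (hq : q ∈ shortVectors Λ)
    (hspan : ∀ w ∈ Λ, ∃ x y : ℤ, w = x • p + y • q) : ∃ i, p i ≠ 0 ∧ q i ≠ 0 := by
  by_contra! hdisj
  have hnz : ∀ v ∈ shortVectors Λ, ∃ i, v i ≠ 0 := fun v hv => by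
    by_contra! h
    simpa [h] using hv.2
  obtain ⟨i, hi⟩ := hnz p hp
  obtain ⟨j, hj⟩ := hnz q hq
  have hqi := hdisj i hi
  have hpj : p j = 0 := by
    by_contra h
    exact hj (hdisj j h)
  obtain ⟨r, hr, hri, hrj⟩ := exists_shortVector_pos_neg hsec hsum hne hp.1 hq.1
    (i := i) (j := j) (by simp [hpj, hi, hj])
  obtain ⟨x, y, rfl⟩ := hspan r hr.1
  have hx : 1 ≤ |x| := Int.one_le_abs (by rintro rfl; simp [hqi] at hri)
  have hy : 1 ≤ |y| := Int.one_le_abs (by rintro rfl; simp [hpj] at hrj)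
  have habs : ∀ k, |(x • p + y • q) k| = |x| * |p k| + |y| * |q k| := by
    intro k
    by_cases hk : p k = 0
    · simp [hk, abs_mul]
    · simp [hdisj k hk, abs_mul]
  have h4 := hr.2
  rw [Finset.sum_congr rfl fun k _ => habs k, Finset.sum_add_distrib, ← Finset.mul_sum,
    ← Finset.mul_sum, hp.2, hq.2] at h4
  linarith

/-- A basis `p, q` of a lattice of vectors of sum zero gives the vertices `u, u + p, u + q` of a
lattice triangle, where `u` is the least vector making all three nonnegative. -/
theorem exists_three_points_of_generating_pair {n : ℕ} {Λ : AddSubgroup (Fin n → ℤ)}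
    (hsum : ∀ v ∈ Λ, ∑ i, v i = 0) {p q : Fin n → ℤ} (hp : p ∈ Λ) (hq : q ∈ Λ)
    (hspan : ∀ w ∈ Λ, ∃ x y : ℤ, w = x • p + y • q) (hp0 : p ≠ 0) (hq0 : q ≠ 0) (hpq : p ≠ q)
    (hcol : ∀ i, p i ≠ 0 ∨ q i ≠ 0) {d : ℕ} (hd : ∑ i, max 0 (max (-p i) (-q i)) = d) :
    ∃ B : Set (Fin n → ℤ), B ⊆ Delta n d ∧ Basepointfree B ∧ Concise B ∧
      B.ncard = 3 ∧ latticeOf B = Λ := by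
  set u : Fin n → ℤ := fun i => max 0 (max (-p i) (-q i)) with hu
  refine ⟨{u, u + p, u + q}, ?_, fun i => ?_, fun i => ?_, ?_, le_antisymm ?_ fun w hw => ?_⟩
  · rintro v (rfl | rfl | rfl)
    · exact ⟨fun i => le_max_left _ _, hd⟩
    · refine ⟨fun i => ?_, by simp [Finset.sum_add_distrib, hd, hsum p hp]⟩
      simp only [hu, Pi.add_apply]
      grind
    · refine ⟨fun i => ?_, by simp [Finset.sum_add_distrib, hd, hsum q hq]⟩
      simp only [hu, Pi.add_apply]
      grind
  · have : u i = 0 ∨ (u + p) i = 0 ∨ (u + q) i = 0 := by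
      simp only [hu, Pi.add_apply]
      grind
    rcases this with h | h | h
    · exact ⟨_, by simp, h⟩
    · exact ⟨_, by simp, h⟩
    · exact ⟨_, by simp, h⟩
  · have : u i ≠ 0 ∨ (u + p) i ≠ 0 ∨ (u + q) i ≠ 0 := by
      have := hcol i
      simp only [Pi.add_apply]
      grind
    rcases this with h | h | h
    · exact ⟨_, by simp, h⟩
    · exact ⟨_, by simp, h⟩
    · exact ⟨_, by simp, h⟩
  · rw [Set.ncard_eq_three]
    exact ⟨u, u + p, u + q, by simpa using hp0, by simpa using hq0, by simpa using hpq, rfl⟩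
  · rw [latticeOf, AddSubgroup.closure_le]
    have hmem : ∀ v ∈ ({u, u + p, u + q} : Set (Fin n → ℤ)), v - u ∈ Λ := by
      rintro v (rfl | rfl | rfl)
      · simp [zero_mem]
      · simpa using hp
      · simpa using hq
    rintro _ ⟨v, hv, w, hw, rfl⟩
    simpa using sub_mem (hmem v hv) (hmem w hw)
  · obtain ⟨x, y, rfl⟩ := hspan w hw
    exact add_mem
      (zsmul_mem (AddSubgroup.subset_closure (by exact ⟨u + p, by simp, u, by simp, by simp⟩)) x)
      (zsmul_mem (AddSubgroup.subset_closure (by exact ⟨u + q, by simp, u, by simp, by simp⟩)) y)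

theorem sum_eq_zero_of_mem_latticeOf {n d : ℕ} {B : Set (Fin n → ℤ)} (hB : B ⊆ Delta n d)
    {v : Fin n → ℤ} (hv : v ∈ latticeOf B) : ∑ i, v i = 0 := by
  induction hv using AddSubgroup.closure_induction with
  | mem x hx =>
    obtain ⟨a, ha, b, hb, rfl⟩ := hx
    simp [(hB ha).2, (hB hb).2]
  | zero => simp
  | add x y _ _ hx hy => simp [Finset.sum_add_distrib, hx, hy]
  | neg x _ hx => simpa using hx

theorem exists_mem_latticeOf_ne_zero {n : ℕ} {B : Set (Fin n → ℤ)} (hbpf : Basepointfree B)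
    (hconc : Concise B) (i : Fin n) : ∃ v ∈ latticeOf B, v i ≠ 0 := by
  obtain ⟨v, hv, hvi⟩ := hconc i
  obtain ⟨w, hw, hwi⟩ := hbpf i
  exact ⟨v - w, AddSubgroup.subset_closure ⟨v, hv, w, hw, rfl⟩, by simpa [hwi] using hvi⟩

/-- The sum of coordinatewise maxima is at most `3` when the negative parts, each of sum `2`,
overlap. -/
theorem sum_max_neg_le_three {n : ℕ} {p q : Fin n → ℤ} (hp : ∑ i, p i = 0) (hq : ∑ i, q i = 0)
    (hp4 : ∑ i, |p i| = 4) (hq4 : ∑ i, |q i| = 4) {i : Fin n} (hpi : p i < 0) (hqi : q i < 0) :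
    ∑ i, max 0 (max (-p i) (-q i)) ≤ 3 := by
  have h : 2 * (∑ k, max 0 (max (-p k) (-q k)) + ∑ k, (Pi.single i 1 : Fin n → ℤ) k)
      ≤ ∑ k, (|p k| - p k) + ∑ k, (|q k| - q k) := by
    rw [← Finset.sum_add_distrib, ← Finset.sum_add_distrib, Finset.mul_sum]
    refine Finset.sum_le_sum fun k _ => ?_
    by_cases hk : k = i
    · subst hk
      rw [Pi.single_eq_same]
      clear hp hq hp4 hq4
      grind
    · rw [Pi.single_eq_of_ne hk]
      clear hp hq hp4 hq4
      grind
  rw [Finset.sum_sub_distrib, Finset.sum_sub_distrib, hp, hq, hp4, hq4] at h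
  simp only [Finset.sum_pi_single', Finset.mem_univ, if_true] at h
  linarith

theorem statement_10 (K : Type*) [Field K] [IsAlgClosed K] [CharZero K]
    (d ℓ : ℕ) (hd : 1 ≤ d) (hl : 2 ≤ ℓ)
    (B : Set (Fin (ℓ + 1) → ℤ))
    (hBΔ : B ⊆ Delta (ℓ + 1) d)
    (hbpf : Basepointfree B)
    (hconc : Concise B)
    (hrank : Module.finrank ℤ (AddSubgroup.toIntSubmodule (latticeOf B)) = 2)
    (hne : ∀ i j : Fin (ℓ + 1), i ≠ j →
      (Pi.single i 1 - Pi.single j 1 : Fin (ℓ + 1) → ℤ) ∉ latticeOf B)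
    (hsec : SecantCondition K (latticeOf B)) :
    ∃ d' : ℕ, d' ≤ 3 ∧ ∃ B' : Set (Fin (ℓ + 1) → ℤ),
      B' ⊆ Delta (ℓ + 1) d' ∧ Basepointfree B' ∧ Concise B' ∧
      B'.ncard = 3 ∧ latticeOf B' = latticeOf B := by
  set Λ := latticeOf B
  have hsum : ∀ v ∈ Λ, ∑ i, v i = 0 := fun v hv => sum_eq_zero_of_mem_latticeOf hBΔ hv
  have hshort : ∀ v ∈ Λ, v ≠ 0 → 4 ≤ ∑ i, |v i| := fun v hv h0 =>
    four_le_sum_abs (hsum v hv) h0 fun i j hij h => hne i j hij (h ▸ hv)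
  obtain ⟨p₀, hp₀, q₀, hq₀, i₀, j₀, hind₀⟩ :=
    exists_independent_shortVectors hsec hrank hsum hne
  obtain ⟨p₁, hp₁, q₁, hq₁, ⟨i₁, j₁, hind₁⟩, hspan₁⟩ :=
    exists_short_generating_pair hrank hshort hp₀ hq₀ hind₀
  obtain ⟨k, hpk, hqk⟩ := exists_ne_zero_and_ne_zero hsec hsum hne hp₁ hq₁ hspan₁
  have hneg : ∀ v ∈ shortVectors Λ, v k ≠ 0 →
      ∃ s : ℤ, s * s = 1 ∧ s • v ∈ shortVectors Λ ∧ (s • v) k < 0 := by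
    intro v hv hvk
    rcases hvk.lt_or_gt with h | h
    · exact ⟨1, by simp, by simpa using hv, by simpa using h⟩
    · exact ⟨-1, by simp, by simpa using neg_mem_shortVectors hv, by simpa using h⟩
  obtain ⟨s, hs, hp, hpk'⟩ := hneg p₁ hp₁ hpk
  obtain ⟨t, ht, hq, hqk'⟩ := hneg q₁ hq₁ hqk
  have hspan : ∀ w ∈ Λ, ∃ x y : ℤ, w = x • (s • p₁) + y • (t • q₁) := by
    intro w hw
    obtain ⟨x, y, rfl⟩ := hspan₁ w hw
    exact ⟨x * s, y * t, by simp only [smul_smul, mul_assoc, hs, ht, mul_one]⟩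
  have hle := sum_max_neg_le_three (hsum _ hp.1) (hsum _ hq.1) hp.2 hq.2 hpk' hqk'
  obtain ⟨d', hd'⟩ := Int.eq_ofNat_of_zero_le
    (Finset.sum_nonneg fun i (_ : i ∈ Finset.univ) =>
      le_max_left 0 (max (-(s • p₁) i) (-(t • q₁) i)))
  refine ⟨d', by rw [hd'] at hle; exact_mod_cast hle,
    exists_three_points_of_generating_pair hsum hp.1 hq.1 hspan
      (fun h => by rw [h] at hpk'; exact hpk'.ne rfl)
      (fun h => by rw [h] at hqk'; exact hqk'.ne rfl) (fun h => hind₁ ?_)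
      (fun i => ?_) hd'⟩
  · have h' : ∀ m, s * p₁ m = t * q₁ m := fun m => by simpa using congrFun h m
    linear_combination (-(p₁ i₁ * q₁ j₁) + p₁ j₁ * q₁ i₁) * hs
      + s * q₁ j₁ * h' i₁ - s * q₁ i₁ * h' j₁
  · obtain ⟨v, hv, hvi⟩ := exists_mem_latticeOf_ne_zero hbpf hconc i
    by_contra! h
    obtain ⟨x, y, rfl⟩ := hspan v hv
    exact hvi (by rw [Pi.add_apply, Pi.smul_apply x, Pi.smul_apply y, h.1, h.2]; simp)
end
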